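/- arXiv:1907.00626 — 2 statements merged into one kernel-verified Lean document; each statement's English description precedes it below -/
import Mathlib

section
/- Let k be a field and 𝒢 a digraph. For maps λ₁, λ₂ : E(𝒢) → k and μ₁, μ₂ : E(𝒢) → kˣ, the coalgebra automorphisms of C(𝒢) fixing all vertices satisfy the composition law f_{λ₂,μ₂} ∘ f_{λ₁,μ₁} = f_{λ₁ + μ₁λ₂, μ₁μ₂}, where f_{λ,μ} denotes f^{id}_{λ,μ} and (λ₁ + μ₁λ₂)(e) = λ₁(e) + μ₁(e)λ₂(e), (μ₁μ₂)(e) = μ₁(e)μ₂(e) for each edge e. -/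
open TensorProduct

variable (k : Type*) [Field k] {V : Type*} (E : Set (V × V))

/-- The underlying vector space of the coalgebra `C(𝒢)`: free on vertices ⊔ edges. -/
abbrev DigraphCoalgebraCarrier : Type _ := (V ⊕ ↥E) →₀ k

/-- Comultiplication of `C(𝒢)`. -/
noncomputable def digraphComul :
    DigraphCoalgebraCarrier k E →ₗ[k] DigraphCoalgebraCarrier k E ⊗[k] DigraphCoalgebraCarrier k E :=
  Finsupp.lift _ k _ fun x =>
    match x with
    | Sum.inl v => Finsupp.single (Sum.inl v) (1 : k) ⊗ₜ[k] Finsupp.single (Sum.inl v) (1 : k)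
    | Sum.inr e =>
        Finsupp.single (Sum.inl e.1.1) (1 : k) ⊗ₜ[k] Finsupp.single (Sum.inr e) (1 : k) +
          Finsupp.single (Sum.inr e) (1 : k) ⊗ₜ[k] Finsupp.single (Sum.inl e.1.2) (1 : k)

/-- Counit of `C(𝒢)`. -/
noncomputable def digraphCounit : DigraphCoalgebraCarrier k E →ₗ[k] k :=
  Finsupp.lift _ k _ (Sum.elim (fun _ => (1 : k)) fun _ => (0 : k))

/-- A digraph automorphism (a bijection of the vertices preserving the edge relation in both
directions) acts on the edges. -/
def edgeMap (σ : V ≃ V) (hσ : ∀ v w : V, (v, w) ∈ E ↔ (σ v, σ w) ∈ E) : ↥E → ↥E :=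
  fun e => ⟨(σ e.1.1, σ e.1.2), (hσ e.1.1 e.1.2).1 e.2⟩

/-- The linear map `f^σ_{λ,μ}` on `C(𝒢)`. -/
noncomputable def fAut (σ : V ≃ V) (hσ : ∀ v w : V, (v, w) ∈ E ↔ (σ v, σ w) ∈ E)
    (lam : ↥E → k) (mu : ↥E → kˣ) :
    DigraphCoalgebraCarrier k E →ₗ[k] DigraphCoalgebraCarrier k E :=
  Finsupp.lift _ k _ fun x =>
    match x with
    | Sum.inl v => Finsupp.single (Sum.inl (σ v)) (1 : k)
    | Sum.inr e =>
        lam e • (Finsupp.single (Sum.inl (σ e.1.2)) (1 : k) -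
            Finsupp.single (Sum.inl (σ e.1.1)) (1 : k)) +
          (mu e : k) • Finsupp.single (Sum.inr (edgeMap E σ hσ e)) (1 : k)

/-- The identity is a digraph automorphism. -/
theorem refl_cond : ∀ v w : V, (v, w) ∈ E ↔ (Equiv.refl V v, Equiv.refl V w) ∈ E :=
  fun _ _ => Iff.rfl

theorem fAut_single_inl (σ : V ≃ V) (hσ : ∀ v w : V, (v, w) ∈ E ↔ (σ v, σ w) ∈ E)
    (lam : ↥E → k) (mu : ↥E → kˣ) (v : V) :
    fAut k E σ hσ lam mu (Finsupp.single (Sum.inl v) 1) = Finsupp.single (Sum.inl (σ v)) 1 := by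
  simp [fAut]

theorem fAut_single_inr (σ : V ≃ V) (hσ : ∀ v w : V, (v, w) ∈ E ↔ (σ v, σ w) ∈ E)
    (lam : ↥E → k) (mu : ↥E → kˣ) (e : ↥E) :
    fAut k E σ hσ lam mu (Finsupp.single (Sum.inr e) 1) =
      lam e • (Finsupp.single (Sum.inl (σ e.1.2)) (1 : k) -
          Finsupp.single (Sum.inl (σ e.1.1)) (1 : k)) +
        (mu e : k) • Finsupp.single (Sum.inr (edgeMap E σ hσ e)) (1 : k) := by
  simp only [fAut, Finsupp.lift_apply, Finsupp.sum_single_index, zero_smul, one_smul]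

theorem edgeMap_refl (e : ↥E) : edgeMap E (Equiv.refl V) (refl_cond E) e = e := rfl

theorem stmt4 (lam₁ lam₂ : ↥E → k) (mu₁ mu₂ : ↥E → kˣ) :
    (fAut k E (Equiv.refl V) (refl_cond E) lam₂ mu₂).comp
        (fAut k E (Equiv.refl V) (refl_cond E) lam₁ mu₁) =
      fAut k E (Equiv.refl V) (refl_cond E)
        (fun e => lam₁ e + (mu₁ e : k) * lam₂ e) (fun e => mu₁ e * mu₂ e) := by
  refine Finsupp.lhom_ext' fun x => LinearMap.ext_ring ?_
  rcases x with v | e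
  · simp only [LinearMap.comp_apply, Finsupp.lsingle_apply, fAut_single_inl, Equiv.refl_apply]
  · simp only [LinearMap.comp_apply, Finsupp.lsingle_apply, fAut_single_inr, fAut_single_inl,
      map_add, map_sub, map_smul, Equiv.refl_apply, edgeMap_refl, Units.val_mul]
    module
end

section
/- Let k be a finite field of order pⁿ with p prime, and let G and H be groups in the class 𝔊_{p,n}. The following are equivalent: (1) G and H are isomorphic; (2) for every k-coalgebra C, G acts faithfully on C by coalgebra automorphisms if and only if H acts faithfully on C by coalgebra automorphisms. -/
open TensorProduct

universe u v w

/-- A bundled `k`-coalgebra. -/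
structure BundledCoalgebra.{w', u'} (k : Type u') [Field k] : Type (max u' (w' + 1)) where
  carrier : Type w'
  [addCommGroup : AddCommGroup carrier]
  [module : Module k carrier]
  [coalgebra : Coalgebra k carrier]

attribute [instance] BundledCoalgebra.addCommGroup BundledCoalgebra.module
  BundledCoalgebra.coalgebra

variable (k : Type u) [Field k]

/-- The group of coalgebra automorphisms of a `k`-coalgebra `C`, as a subgroup of the linear
automorphisms of `C`: the bijective linear maps `f` with `ε ∘ f = ε` and
`Δ ∘ f = (f ⊗ f) ∘ Δ`. -/
noncomputable def coalgAut (C : Type w) [AddCommGroup C] [Module k C] [Coalgebra k C] :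
    Subgroup (C ≃ₗ[k] C) where
  carrier := {f | (∀ c, Coalgebra.counit (R := k) (f c) = Coalgebra.counit (R := k) c) ∧
    ∀ c, Coalgebra.comul (R := k) (f c) =
      TensorProduct.map f.toLinearMap f.toLinearMap (Coalgebra.comul c)}
  one_mem' := by
    refine ⟨fun c => rfl, fun c => ?_⟩
    show Coalgebra.comul c = TensorProduct.map LinearMap.id LinearMap.id (Coalgebra.comul c)
    rw [TensorProduct.map_id, LinearMap.id_apply]
  mul_mem' := by
    rintro f g ⟨hf1, hf2⟩ ⟨hg1, hg2⟩
    refine ⟨fun c => ?_, fun c => ?_⟩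
    · show Coalgebra.counit (R := k) (f (g c)) = _
      rw [hf1, hg1]
    · show Coalgebra.comul (R := k) (f (g c)) =
        TensorProduct.map (f.toLinearMap ∘ₗ g.toLinearMap)
          (f.toLinearMap ∘ₗ g.toLinearMap) (Coalgebra.comul c)
      rw [hf2, hg2, TensorProduct.map_comp, LinearMap.comp_apply]
  inv_mem' := by
    rintro f ⟨hf1, hf2⟩
    have key : ∀ x, TensorProduct.map f.symm.toLinearMap f.symm.toLinearMap
        (TensorProduct.map f.toLinearMap f.toLinearMap x) = x := by
      intro x
      rw [← LinearMap.comp_apply, ← TensorProduct.map_comp]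
      have h : f.symm.toLinearMap ∘ₗ f.toLinearMap = (LinearMap.id : C →ₗ[k] C) := by
        ext y
        simp
      rw [h, TensorProduct.map_id, LinearMap.id_apply]
    refine ⟨fun c => ?_, fun c => ?_⟩
    · have h := hf1 (f.symm c)
      rw [f.apply_symm_apply] at h
      exact h.symm
    · have h := hf2 (f.symm c)
      rw [f.apply_symm_apply] at h
      show Coalgebra.comul (R := k) (f.symm c) =
        TensorProduct.map f.symm.toLinearMap f.symm.toLinearMap (Coalgebra.comul c)
      rw [h, key]

/-- The set of grouplike elements of a `k`-coalgebra `C`. -/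
def grouplikes (C : Type w) [AddCommGroup C] [Module k C] [Coalgebra k C] : Set C :=
  {c | Coalgebra.comul (R := k) c = c ⊗ₜ[k] c ∧ Coalgebra.counit (R := k) c = 1}

/-- The action of `kˣ` on the additive group of `k` by multiplication, as a homomorphism
into the automorphisms of `Multiplicative k`. -/
def unitsMulAction : kˣ →* MulAut (Multiplicative k) where
  toFun u := AddEquiv.toMultiplicative (DistribMulAction.toAddAut kˣ k u)
  map_one' := by ext x; simp
  map_mul' u v := by ext x; simp [mul_smul]

/-- The semidirect product `k ⋊ kˣ` of the additive group of `k` by the multiplicative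
group `kˣ` acting by multiplication. -/
def AffGroup : Type u :=
  SemidirectProduct (Multiplicative k) kˣ (unitsMulAction k)

noncomputable instance : Group (AffGroup k) :=
  inferInstanceAs (Group (SemidirectProduct _ _ _))

/-- A group is co-Hopfian if every injective endomorphism is surjective, i.e. it has no
proper subgroup isomorphic to itself. -/
def CoHopfian (G : Type*) [Group G] : Prop :=
  ∀ f : G →* G, Function.Injective f → Function.Surjective f

/-- The class `𝔊_{p,n}`: co-Hopfian groups with no finite non-trivial normal subgroup whose
exponent divides `p^n (p^n - 1)`. -/
def InClassG (p n : ℕ) (G : Type*) [Group G] : Prop :=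
  CoHopfian G ∧
    ∀ N : Subgroup G, N.Normal → Finite N → Monoid.exponent N ∣ p ^ n * (p ^ n - 1) → N = ⊥

/-- `G` acts faithfully on the coalgebra `C` by coalgebra automorphisms. -/
def HasFaithfulAction (G : Type v) [Group G] (C : BundledCoalgebra.{w} k) : Prop :=
  ∃ a : G →* ↥(coalgAut k C.carrier), Function.Injective a

set_option linter.unusedSectionVars false

/-- The coalgebra of finitely supported functions on a monoid with finite antidiagonals, whose
comultiplication sends a basis vector to the sum over all its decompositions. -/
def DecompCoalg (k : Type*) (M : Type*) [Zero k] : Type _ := M →₀ k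

namespace DecompCoalg

section Coalgebra

variable (k : Type u) [Field k] (M : Type w) [AddCommMonoid M]

noncomputable instance : AddCommGroup (DecompCoalg k M) := inferInstanceAs (AddCommGroup (M →₀ k))

noncomputable instance : Module k (DecompCoalg k M) := inferInstanceAs (Module k (M →₀ k))

variable {M}

/-- The basis vector indexed by `m`. -/
noncomputable def basis (m : M) : DecompCoalg k M := Finsupp.single m (1 : k)

/-- The linear extension of a function on the basis. -/
noncomputable def lift {N : Type*} [AddCommGroup N] [Module k N] (f : M → N) :
    DecompCoalg k M →ₗ[k] N := Finsupp.linearCombination k f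

variable {k}

@[simp]
theorem lift_basis {N : Type*} [AddCommGroup N] [Module k N] (f : M → N) (m : M) :
    lift k f (basis k m) = f m :=
  (Finsupp.linearCombination_single k 1 m).trans (one_smul k _)

theorem hom_ext {N : Type*} [AddCommGroup N] [Module k N] {f g : DecompCoalg k M →ₗ[k] N}
    (h : ∀ m, f (basis k m) = g (basis k m)) : f = g :=
  Finsupp.lhom_ext' fun m => LinearMap.ext_ring (h m)

variable [Finset.HasAntidiagonal M]

open Classical in
noncomputable instance : CoalgebraStruct k (DecompCoalg k M) where
  comul := lift k fun m => ∑ x ∈ Finset.HasAntidiagonal.antidiagonal m, basis k x.1 ⊗ₜ[k] basis k x.2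
  counit := lift k fun m => if m = 0 then 1 else 0

@[simp]
theorem comul_basis (m : M) : CoalgebraStruct.comul (R := k) (basis k m) =
    ∑ x ∈ Finset.HasAntidiagonal.antidiagonal m, basis k x.1 ⊗ₜ[k] basis k x.2 :=
  lift_basis _ m

open Classical in
@[simp]
theorem counit_basis (m : M) : CoalgebraStruct.counit (R := k) (basis k m) =
    if m = 0 then 1 else 0 := by
  simp only [CoalgebraStruct.counit, lift_basis]

noncomputable instance : Coalgebra k (DecompCoalg k M) where
  coassoc := by
    refine hom_ext fun m => ?_
    simp only [LinearMap.comp_apply, comul_basis, map_sum, LinearMap.rTensor_tmul,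
      LinearMap.lTensor_tmul, TensorProduct.sum_tmul, TensorProduct.tmul_sum,
      LinearEquiv.coe_coe, TensorProduct.assoc_tmul, Finset.sum_sigma']
    refine Finset.sum_nbij' (fun x => ⟨(x.2.1, x.2.2 + x.1.2), (x.2.2, x.1.2)⟩)
      (fun x => ⟨(x.1.1 + x.2.1, x.2.2), (x.1.1, x.2.1)⟩) ?_ ?_ ?_ ?_ ?_
    all_goals
      rintro ⟨⟨a, b⟩, ⟨c, d⟩⟩ h
      simp only [Finset.mem_sigma, Finset.HasAntidiagonal.mem_antidiagonal] at h
      obtain ⟨h1, rfl⟩ := h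
      simp [← h1, add_assoc]
  rTensor_counit_comp_comul := by
    classical
    refine hom_ext fun m => ?_
    simp only [LinearMap.comp_apply, comul_basis, map_sum, LinearMap.rTensor_tmul,
      counit_basis, TensorProduct.mk_apply]
    rw [Finset.sum_eq_single (0, m)]
    · simp
    · rintro ⟨a, b⟩ hab hne
      rw [Finset.HasAntidiagonal.mem_antidiagonal] at hab
      have ha : a ≠ 0 := by
        rintro rfl
        exact hne (by simpa using hab)
      simp [ha]
    · simp
  lTensor_counit_comp_comul := by
    classical
    refine hom_ext fun m => ?_
    simp only [LinearMap.comp_apply, comul_basis, map_sum, LinearMap.lTensor_tmul,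
      counit_basis, LinearMap.flip_apply, TensorProduct.mk_apply]
    rw [Finset.sum_eq_single (m, 0)]
    · simp
    · rintro ⟨a, b⟩ hab hne
      rw [Finset.HasAntidiagonal.mem_antidiagonal] at hab
      have ha : b ≠ 0 := by
        rintro rfl
        exact hne (by simpa using hab)
      simp [ha]
    · simp

/-- An additive automorphism of the monoid permutes the basis and acts by coalgebra
automorphisms. -/
noncomputable def ofAddEquiv (e : M ≃+ M) : coalgAut k (DecompCoalg k M) where
  val := LinearEquiv.ofLinearMap (lift k fun m => basis k (e m)) (lift k fun m => basis k (e.symm m))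
    (hom_ext fun m => by simp) (hom_ext fun m => by simp)
  property := by
    classical
    refine ⟨fun c => ?_, fun c => ?_⟩
    · refine LinearMap.congr_fun (f := CoalgebraStruct.counit ∘ₗ (lift k fun m => basis k (e m)))
        (g := CoalgebraStruct.counit) (hom_ext fun m => ?_) c
      simp
    · refine LinearMap.congr_fun (f := CoalgebraStruct.comul ∘ₗ (lift k fun m => basis k (e m)))
        (g := TensorProduct.map (lift k fun m => basis k (e m)) (lift k fun m => basis k (e m)) ∘ₗ
          CoalgebraStruct.comul) (hom_ext fun m => ?_) c
      simp only [LinearMap.comp_apply, lift_basis, comul_basis, map_sum, TensorProduct.map_tmul]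
      symm
      refine Finset.sum_nbij' (fun x => (e x.1, e x.2)) (fun x => (e.symm x.1, e.symm x.2))
        ?_ ?_ ?_ ?_ ?_
      · rintro ⟨a, b⟩ h
        rw [Finset.HasAntidiagonal.mem_antidiagonal] at h ⊢
        rw [← map_add, h]
      · rintro ⟨a, b⟩ h
        rw [Finset.HasAntidiagonal.mem_antidiagonal] at h ⊢
        rw [← map_add, h, e.symm_apply_apply]
      · simp
      · simp
      · simp

@[simp]
theorem ofAddEquiv_basis (e : M ≃+ M) (m : M) :
    (ofAddEquiv (k := k) e).1 (basis k m) = basis k (e m) :=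
  lift_basis _ m

theorem basis_injective : Function.Injective (basis k : M → DecompCoalg k M) := fun a b h => by
  simpa using (Finsupp.single_eq_single_iff _ _ _ _).1 h

theorem coalgAut_ext {f g : coalgAut k (DecompCoalg k M)}
    (h : ∀ m, f.1 (basis k m) = g.1 (basis k m)) : f = g :=
  Subtype.ext (LinearEquiv.toLinearMap_injective (hom_ext h))

variable (k) in
/-- An action on the monoid by additive automorphisms yields an action by coalgebra
automorphisms. -/
noncomputable def ofAction {G : Type*} [Group G] (a : G → M ≃+ M)
    (hmul : ∀ g h m, a (g * h) m = a g (a h m)) : G →* coalgAut k (DecompCoalg k M) :=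
  MonoidHom.mk' (fun g => ofAddEquiv (a g)) fun g h => coalgAut_ext fun m => by
    rw [ofAddEquiv_basis, hmul]
    change _ = (ofAddEquiv (k := k) (a g)).1 ((ofAddEquiv (k := k) (a h)).1 (basis k m))
    rw [ofAddEquiv_basis, ofAddEquiv_basis]

theorem ofAction_injective {G : Type*} [Group G] {a : G → M ≃+ M}
    {hmul : ∀ g h m, a (g * h) m = a g (a h m)} (ha : Function.Injective a) :
    Function.Injective (ofAction k a hmul) := fun g h hgh => by
  refine ha (AddEquiv.ext fun m => basis_injective (k := k) ?_)
  rw [← ofAddEquiv_basis, ← ofAddEquiv_basis]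
  exact congrArg (fun f : coalgAut k (DecompCoalg k M) => f.1 (basis k m)) hgh

end Coalgebra

section Dual

variable {k : Type u} [Field k] {M : Type w} [AddCommMonoid M] [LinearOrder M]
  [IsOrderedCancelAddMonoid M] [WellFoundedLT M] [Finset.HasAntidiagonal M]

/-- The pairing of a Hahn series with an element of the coalgebra. -/
noncomputable def pair (y : HahnSeries M k) : DecompCoalg k M →ₗ[k] k := lift k y.coeff

@[simp]
theorem pair_basis (y : HahnSeries M k) (m : M) : pair y (basis k m) = y.coeff m :=
  lift_basis _ m

theorem pair_mul (x y : HahnSeries M k) : pair (x * y) =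
    LinearMap.mul' k k ∘ₗ TensorProduct.map (pair x) (pair y) ∘ₗ CoalgebraStruct.comul := by
  refine hom_ext fun m => ?_
  simp only [pair_basis, LinearMap.comp_apply, comul_basis, map_sum, TensorProduct.map_tmul,
    LinearMap.mul'_apply]
  rw [HahnSeries.coeff_mul]
  refine Finset.sum_subset (fun z hz => ?_) fun z hz hz' => ?_
  · rw [Finset.HasAntidiagonal.mem_antidiagonal]
    exact (Finset.mem_antidiagonal.1 hz).2.2
  · rw [Finset.HasAntidiagonal.mem_antidiagonal] at hz
    by_contra hne
    exact hz' (Finset.mem_antidiagonal.2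
      ⟨left_ne_zero_of_mul hne, right_ne_zero_of_mul hne, hz⟩)

theorem pair_one : pair (1 : HahnSeries M k) = CoalgebraStruct.counit := by
  classical
  refine hom_ext fun m => ?_
  rw [pair_basis, counit_basis, HahnSeries.coeff_one]

theorem pair_add (x y : HahnSeries M k) : pair (x + y) = pair x + pair y :=
  hom_ext fun m => by simp

theorem pair_zero : pair (0 : HahnSeries M k) = 0 := hom_ext fun m => by simp

theorem pair_injective : Function.Injective (pair : HahnSeries M k → _) := fun x y h =>
  HahnSeries.ext (funext fun m => by rw [← pair_basis, h, pair_basis])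

/-- The Hahn series representing a linear form on the coalgebra. -/
noncomputable def ofForm (l : DecompCoalg k M →ₗ[k] k) : HahnSeries M k where
  coeff m := l (basis k m)
  isPWO_support' := Set.isPWO_of_wellQuasiOrderedLE _

theorem pair_ofForm (l : DecompCoalg k M →ₗ[k] k) : pair (ofForm l) = l :=
  hom_ext fun m => by rw [pair_basis]; rfl

/-- The transpose of a coalgebra automorphism, as a ring endomorphism of the Hahn series ring. -/
noncomputable def transpose (f : coalgAut k (DecompCoalg k M)) :
    HahnSeries M k →+* HahnSeries M k where
  toFun y := ofForm (pair y ∘ₗ f.1.toLinearMap)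
  map_zero' := by
    refine pair_injective ?_
    rw [pair_ofForm, pair_zero, LinearMap.zero_comp]
  map_one' := by
    refine pair_injective ?_
    rw [pair_ofForm, pair_one]
    exact LinearMap.ext f.2.1
  map_add' x y := by
    refine pair_injective ?_
    rw [pair_ofForm, pair_add, pair_add, pair_ofForm, pair_ofForm, LinearMap.add_comp]
  map_mul' x y := by
    refine pair_injective ?_
    rw [pair_ofForm, pair_mul, pair_mul, pair_ofForm, pair_ofForm, TensorProduct.map_comp]
    refine LinearMap.ext fun c => ?_
    exact congrArg (fun t => LinearMap.mul' k k (TensorProduct.map (pair x) (pair y) t)) (f.2.2 c)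

theorem pair_transpose (f : coalgAut k (DecompCoalg k M)) (y : HahnSeries M k) :
    pair (transpose f y) = pair y ∘ₗ f.1.toLinearMap :=
  pair_ofForm _

theorem transpose_one (y : HahnSeries M k) : transpose 1 y = y :=
  pair_injective (by rw [pair_transpose]; rfl)

theorem transpose_mul (f g : coalgAut k (DecompCoalg k M)) (y : HahnSeries M k) :
    transpose (f * g) y = transpose g (transpose f y) :=
  pair_injective (by rw [pair_transpose, pair_transpose, pair_transpose]; rfl)

theorem transpose_inv_apply (f : coalgAut k (DecompCoalg k M)) (y : HahnSeries M k) :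
    transpose f⁻¹ (transpose f y) = y := by
  rw [← transpose_mul, mul_inv_cancel, transpose_one]

theorem transpose_apply_inv (f : coalgAut k (DecompCoalg k M)) (y : HahnSeries M k) :
    transpose f (transpose f⁻¹ y) = y := by
  rw [← transpose_mul, inv_mul_cancel, transpose_one]

theorem eq_one_of_transpose_single {f : coalgAut k (DecompCoalg k M)}
    (h : ∀ m, transpose f (HahnSeries.single m 1) = HahnSeries.single m 1) : f = 1 := by
  classical
  refine coalgAut_ext fun m => Finsupp.ext fun a => ?_
  have key : ∀ c : DecompCoalg k M, pair (HahnSeries.single a (1 : k)) c =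
      Finsupp.lapply (R := k) (M := k) a c := by
    intro c
    refine LinearMap.congr_fun (g := Finsupp.lapply (R := k) (M := k) a) (hom_ext fun b => ?_) c
    rw [pair_basis, HahnSeries.coeff_single]
    change _ = Finsupp.single b (1 : k) a
    rw [Finsupp.single_apply]
    simp only [eq_comm]
  have h1 := congrArg (fun y => pair y (basis k m)) (h a)
  simp only [pair_transpose, LinearMap.comp_apply] at h1
  exact (key _).symm.trans (h1.trans (key _))

end Dual

end DecompCoalg

namespace HahnSeries

section Tail

variable {K : Type*} [Field K] {Γ : Type*} [AddCommMonoid Γ] [LinearOrder Γ]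
  [IsOrderedCancelAddMonoid Γ]

/-- A Hahn series with its leading term removed. -/
noncomputable def tail (y : HahnSeries Γ K) : HahnSeries Γ K := y - single y.order y.leadingCoeff

theorem single_add_tail (y : HahnSeries Γ K) : single y.order y.leadingCoeff + y.tail = y :=
  add_sub_cancel _ _

theorem order_lt_orderTop_tail (y : HahnSeries Γ K) :
    (y.order : WithTop Γ) < y.tail.orderTop := by
  by_contra hle
  rw [not_lt] at hle
  have hne : y.tail ≠ 0 := by
    rw [← orderTop_lt_top]
    exact hle.trans_lt (WithTop.coe_lt_top _)
  have h1 : y.tail.order ≤ y.order := by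
    rwa [← order_eq_orderTop_of_ne_zero hne, WithTop.coe_le_coe] at hle
  have h2 : y.tail.coeff y.tail.order ≠ 0 := fun h => hne (coeff_order_eq_zero.1 h)
  rw [tail, coeff_sub] at h2
  rcases h1.lt_or_eq with h | h
  · rw [tail] at h
    rw [coeff_eq_zero_of_lt_order h, coeff_single_of_ne h.ne, sub_zero] at h2
    exact h2 rfl
  · rw [tail] at h
    rw [h, coeff_single_same, leadingCoeff_eq, sub_self] at h2
    exact h2 rfl

theorem order_lt_order_tail {y : HahnSeries Γ K} (hy : y.tail ≠ 0) : y.order < y.tail.order := by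
  have h := order_lt_orderTop_tail y
  rwa [← order_eq_orderTop_of_ne_zero hy, WithTop.coe_lt_coe] at h

@[simp]
theorem tail_single (a : Γ) (c : K) : (single a c).tail = 0 := by
  rcases eq_or_ne c 0 with rfl | hc
  · simp [tail]
  · rw [tail, order_single hc, leadingCoeff_of_single, sub_self]

theorem order_leadingCoeff_tail_of_eq {y w : HahnSeries Γ K} {a : Γ} {c : K} (hc : c ≠ 0)
    (hw : (a : WithTop Γ) < w.orderTop) (hy : y = single a c + w) :
    y.order = a ∧ y.leadingCoeff = c ∧ y.tail = w := by
  have h1 : (single a c).orderTop < w.orderTop := by rwa [orderTop_single hc]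
  have h2 : y.orderTop = a := by rw [hy, orderTop_add_eq_left h1, orderTop_single hc]
  have hy0 : y ≠ 0 := by
    rw [← orderTop_lt_top, h2]
    exact WithTop.coe_lt_top a
  have h3 : y.order = a := by
    rwa [← order_eq_orderTop_of_ne_zero hy0, WithTop.coe_inj] at h2
  have h4 : y.leadingCoeff = c := by
    rw [leadingCoeff_eq, h3, hy, coeff_add, coeff_single_same, coeff_eq_zero_of_lt_orderTop hw,
      add_zero]
  refine ⟨h3, h4, ?_⟩
  rw [tail, h3, h4, hy, add_sub_cancel_left]

theorem lt_orderTop_mul {x y : HahnSeries Γ K} {a b : Γ} (hx : (a : WithTop Γ) ≤ x.orderTop)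
    (hy : (b : WithTop Γ) < y.orderTop) : ((a + b : Γ) : WithTop Γ) < (x * y).orderTop :=
  (WithTop.add_lt_add_of_le_of_lt WithTop.coe_ne_top hx hy).trans_le orderTop_add_le_mul

theorem lt_orderTop_add {x y : HahnSeries Γ K} {a : WithTop Γ} (hx : a < x.orderTop)
    (hy : a < y.orderTop) : a < (x + y).orderTop :=
  (lt_min hx hy).trans_le min_orderTop_le_orderTop_add

theorem exists_single_add_pow_succ (a b : Γ) (hab : a < b) (c : K) (w : HahnSeries Γ K)
    (hw : w.orderTop = b) (n : ℕ) :
    ∃ h : HahnSeries Γ K, ((n • a + b : Γ) : WithTop Γ) < h.orderTop ∧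
      (single a c + w) ^ (n + 1) = single ((n + 1) • a) (c ^ (n + 1)) +
        single (n • a) ((n + 1 : K) * c ^ n) * w + h := by
  induction n with
  | zero => exact ⟨0, by simp, by simp⟩
  | succ n ih =>
    obtain ⟨h, hh, e⟩ := ih
    refine ⟨h * single a c + single (n • a) ((n + 1 : K) * c ^ n) * w * w + h * w, ?_, ?_⟩
    · have hs : ((n + 1) • a + b : Γ) = a + (n • a + b) := by rw [succ_nsmul]; abel
      have hwb : (b : WithTop Γ) ≤ w.orderTop := hw.ge
      refine lt_orderTop_add (lt_orderTop_add ?_ ?_) ?_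
      · rw [hs, mul_comm]
        exact lt_orderTop_mul orderTop_single_le hh
      · have hwa : (a : WithTop Γ) < w.orderTop := by rw [hw]; exact WithTop.coe_lt_coe.2 hab
        have h1 : ((n • a + a : Γ) : WithTop Γ) <
            (single (n • a) ((n + 1 : K) * c ^ n) * w).orderTop :=
          lt_orderTop_mul orderTop_single_le hwa
        rw [succ_nsmul, add_comm, mul_comm]
        exact lt_orderTop_mul hwb h1
      · rw [hs, mul_comm]
        refine lt_orderTop_mul ?_ hh
        rw [hw]
        exact WithTop.coe_le_coe.2 hab.le
    · have hb : single (n • a) ((n + 1 : K) * c ^ n) * single a c =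
          single ((n + 1) • a) ((n + 1 : K) * c ^ (n + 1)) := by
        rw [single_mul_single, succ_nsmul, pow_succ, mul_assoc]
      have hb' : single ((n + 1) • a) (c ^ (n + 1)) * single a c =
          single ((n + 1 + 1) • a) (c ^ (n + 1 + 1)) := by
        rw [single_mul_single, succ_nsmul _ (n + 1), pow_succ _ (n + 1)]
      have hb'' : single ((n + 1) • a) (((n + 1 : ℕ) + 1 : K) * c ^ (n + 1)) =
          single ((n + 1) • a) ((n + 1 : K) * c ^ (n + 1)) +
          single ((n + 1) • a) (c ^ (n + 1)) := by
        rw [← single_add, add_mul _ (1 : K), one_mul, Nat.cast_succ]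
      rw [pow_succ, e, hb'', ← hb', ← hb]
      ring

theorem order_tail_pow_of_coprime {y : HahnSeries Γ K} (hy : y.tail ≠ 0) {n : ℕ}
    (hn : (n : K) ≠ 0) : (y ^ n).tail ≠ 0 ∧
      (y ^ n).tail.order + y.order = n • y.order + y.tail.order := by
  have hy0 : y ≠ 0 := by
    rintro rfl
    simp [tail] at hy
  obtain ⟨n, rfl⟩ : ∃ l, n = l + 1 := ⟨n - 1, by
    have : n ≠ 0 := by rintro rfl; simp at hn
    omega⟩
  obtain ⟨h, hh, e⟩ := exists_single_add_pow_succ y.order y.tail.order (order_lt_order_tail hy)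
    y.leadingCoeff y.tail (order_eq_orderTop_of_ne_zero hy).symm n
  rw [single_add_tail] at e
  have hc : (n + 1 : K) * y.leadingCoeff ^ n ≠ 0 :=
    mul_ne_zero (by exact_mod_cast hn) (pow_ne_zero _ (leadingCoeff_ne_zero.2 hy0))
  have h1 : (single (n • y.order) ((n + 1 : K) * y.leadingCoeff ^ n) * y.tail).orderTop =
      (n • y.order + y.tail.order : Γ) := by
    rw [orderTop_mul, orderTop_single hc, ← order_eq_orderTop_of_ne_zero hy, WithTop.coe_add]
  have h2 : (single (n • y.order) ((n + 1 : K) * y.leadingCoeff ^ n) * y.tail + h).orderTop =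
      (n • y.order + y.tail.order : Γ) := by
    rw [orderTop_add_eq_left (by rwa [h1]), h1]
  have h3 := (order_leadingCoeff_tail_of_eq (pow_ne_zero (n + 1) (leadingCoeff_ne_zero.2 hy0))
    (by
      rw [h2, WithTop.coe_lt_coe, succ_nsmul]
      exact add_lt_add_right (order_lt_order_tail hy) _) (e.trans (add_assoc _ _ _))).2.2
  rw [← h3] at h2
  have h4 : (y ^ (n + 1)).tail ≠ 0 := by
    rw [← orderTop_lt_top, h2]
    exact WithTop.coe_lt_top _
  refine ⟨h4, ?_⟩
  rw [← order_eq_orderTop_of_ne_zero h4, WithTop.coe_inj] at h2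
  rw [h2, succ_nsmul]
  abel

theorem tail_pow_char_pow (p : ℕ) [Fact p.Prime] [CharP (HahnSeries Γ K) p]
    (y : HahnSeries Γ K) (e : ℕ) : (y ^ p ^ e).tail = y.tail ^ p ^ e := by
  have hp := (Fact.out : p.Prime)
  rcases eq_or_ne y 0 with rfl | hy
  · simp [tail, hp.ne_zero]
  · have e1 : y ^ p ^ e = single (p ^ e • y.order) (y.leadingCoeff ^ p ^ e) + y.tail ^ p ^ e := by
      conv_lhs => rw [← single_add_tail y, add_pow_char_pow, single_pow]
    refine (order_leadingCoeff_tail_of_eq (pow_ne_zero _ (leadingCoeff_ne_zero.2 hy)) ?_ e1).2.2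
    rcases eq_or_ne y.tail 0 with ht | ht
    · rw [ht, zero_pow (pow_ne_zero _ hp.ne_zero), orderTop_zero]
      exact WithTop.coe_lt_top _
    · rw [← order_eq_orderTop_of_ne_zero (pow_ne_zero _ ht), order_pow, WithTop.coe_lt_coe]
      exact nsmul_lt_nsmul_right (pow_ne_zero _ hp.ne_zero) (order_lt_order_tail ht)

theorem leadingCoeff_pow' (y : HahnSeries Γ K) (n : ℕ) :
    (y ^ n).leadingCoeff = y.leadingCoeff ^ n := by
  induction n with
  | zero => simp [leadingCoeff_eq, ← single_zero_one]
  | succ n ih => rw [pow_succ, leadingCoeff_mul, ih, pow_succ]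

/-- The order of the tail of a power, where the exponent is split into a part prime to the
characteristic and a power of the characteristic. -/
theorem order_tail_pow (p : ℕ) [Fact p.Prime] [CharP (HahnSeries Γ K) p] {y : HahnSeries Γ K}
    (hy : y.tail ≠ 0) {n : ℕ} (hn : (n : K) ≠ 0) (e : ℕ) : (y ^ (n * p ^ e)).tail ≠ 0 ∧
      (y ^ (n * p ^ e)).tail.order + p ^ e • y.order =
        (n * p ^ e) • y.order + p ^ e • y.tail.order := by
  obtain ⟨h1, h2⟩ := order_tail_pow_of_coprime hy hn
  rw [pow_mul, tail_pow_char_pow p]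
  refine ⟨pow_ne_zero _ h1, ?_⟩
  rw [order_pow, ← nsmul_add, h2, nsmul_add, mul_comm, mul_nsmul']

end Tail

end HahnSeries

namespace RigidExponent

/-- The exponents of the left-hand sides of the equations `u ^ D = y ^ N`. -/
def expD (q i : ℕ) : ℕ := (q - 1) ^ i * q ^ (i * i)

/-- The exponents of the right-hand sides of the equations `u ^ D = y ^ N`. -/
def expN (q i : ℕ) : ℕ := (i + 1).factorial * expD q i + 1

/-- The ratio of the two exponents. -/
def ratio (q i : ℕ) : ℚ := expN q i / expD q i

/-- The additive monoid of exponents. -/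
def expS (q : ℕ) : AddSubmonoid ℚ :=
  AddSubmonoid.closure (insert 1 (Set.range fun i => (q : ℚ) ^ 3 * ratio q i))

section

variable {q : ℕ}

theorem expD_pos (hq : 2 ≤ q) (i : ℕ) : 0 < expD q i :=
  Nat.mul_pos (Nat.pow_pos (by omega)) (Nat.pow_pos (by omega))

theorem expD_dvd {i j : ℕ} (h : j ≤ i) : expD q j ∣ expD q i :=
  Nat.mul_dvd_mul (pow_dvd_pow _ h) (pow_dvd_pow _ (Nat.mul_le_mul h h))

theorem expD_succ (i : ℕ) : expD q (i + 1) = (q - 1) * q ^ (2 * i + 1) * expD q i := by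
  have h : (i + 1) * (i + 1) = 2 * i + 1 + i * i := by ring
  rw [expD, expD, h, pow_add, pow_succ]
  ring

theorem ratio_eq (hq : 2 ≤ q) (i : ℕ) :
    ratio q i = (i + 1).factorial + 1 / expD q i := by
  have := expD_pos hq i
  rw [ratio, expN]
  push_cast
  field_simp

theorem ratio_mul_expD (hq : 2 ≤ q) (i : ℕ) : ratio q i * expD q i = expN q i := by
  have := expD_pos hq i
  rw [ratio]
  field_simp

theorem factorial_le_ratio (hq : 2 ≤ q) (i : ℕ) : ((i + 1).factorial : ℚ) ≤ ratio q i := by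
  rw [ratio_eq hq]
  have : (0 : ℚ) ≤ 1 / expD q i := by positivity
  linarith

theorem ratio_le (hq : 2 ≤ q) (i : ℕ) : ratio q i ≤ (i + 1).factorial + 1 := by
  rw [ratio_eq hq]
  have : (1 : ℚ) / expD q i ≤ 1 := by
    rw [div_le_one (by exact_mod_cast expD_pos hq i)]
    exact_mod_cast expD_pos hq i
  linarith

theorem one_le_ratio (hq : 2 ≤ q) (i : ℕ) : 1 ≤ ratio q i :=
  le_trans (by exact_mod_cast Nat.one_le_iff_ne_zero.2 (Nat.factorial_ne_zero _))
    (factorial_le_ratio hq i)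

theorem one_mem_expS : (1 : ℚ) ∈ expS q :=
  AddSubmonoid.subset_closure (Set.mem_insert _ _)

theorem gen_mem_expS (i : ℕ) : (q : ℚ) ^ 3 * ratio q i ∈ expS q :=
  AddSubmonoid.subset_closure (Set.mem_insert_of_mem _ ⟨i, rfl⟩)

theorem one_le_gen (hq : 2 ≤ q) (i : ℕ) : 1 ≤ (q : ℚ) ^ 3 * ratio q i := by
  have h : (1 : ℚ) ≤ (q : ℚ) ^ 3 := one_le_pow₀ (by exact_mod_cast (by omega : 1 ≤ q))
  exact one_le_mul_of_one_le_of_one_le h (one_le_ratio hq i)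

theorem zero_or_one_le_of_mem (hq : 2 ≤ q) {t : ℚ} (ht : t ∈ expS q) : t = 0 ∨ 1 ≤ t := by
  induction ht using AddSubmonoid.closure_induction with
  | mem x hx =>
    rcases hx with rfl | ⟨i, rfl⟩
    · exact Or.inr le_rfl
    · exact Or.inr (one_le_gen hq i)
  | zero => exact Or.inl rfl
  | add x y _ _ hx hy =>
    rcases hx with rfl | hx
    · simpa using hy
    · rcases hy with rfl | hy
      · right; simpa using hx
      · right; linarith

theorem nonneg_of_mem (hq : 2 ≤ q) {t : ℚ} (ht : t ∈ expS q) : 0 ≤ t := by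
  rcases zero_or_one_le_of_mem hq ht with rfl | h
  · exact le_rfl
  · linarith

theorem ratio_monotone (hq : 2 ≤ q) : Monotone (ratio q) := by
  refine monotone_nat_of_le_succ fun i => (ratio_le hq i).trans ?_
  refine le_trans ?_ (factorial_le_ratio hq (i + 1))
  have h : (i + 1).factorial + 1 ≤ (i + 1 + 1).factorial := by
    rw [Nat.factorial_succ (i + 1)]
    have := Nat.factorial_pos (i + 1)
    nlinarith
  exact_mod_cast h

theorem isPWO_expS (hq : 2 ≤ q) : (expS q : Set ℚ).IsPWO := by
  refine Set.IsPWO.addSubmonoid_closure ?_ ?_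
  · rintro x (rfl | ⟨i, rfl⟩)
    · exact zero_le_one
    · exact zero_le_one.trans (one_le_gen hq i)
  · refine Set.IsPWO.insert ?_ 1
    rw [← Set.image_univ]
    refine Set.IsPWO.image_of_monotone (Set.isPWO_of_wellQuasiOrderedLE _) fun i j h => ?_
    exact mul_le_mul_of_nonneg_left (ratio_monotone hq h) (by positivity)

theorem exists_eq_of_mem_of_lt (hq : 2 ≤ q) (i : ℕ) {t : ℚ} (ht : t ∈ expS q)
    (hlt : t < (q : ℚ) ^ 3 * (i + 3).factorial) :
    ∃ c a : ℕ, t = c * ((q : ℚ) ^ 3 * ratio q (i + 1)) + a / expD q i := by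
  have hD : (expD q i : ℚ) ≠ 0 := by exact_mod_cast (expD_pos hq i).ne'
  induction ht using AddSubmonoid.closure_induction with
  | mem x hx =>
    rcases hx with rfl | ⟨j, rfl⟩
    · exact ⟨0, expD q i, by field_simp; simp⟩
    · rcases lt_trichotomy j (i + 1) with h | rfl | h
      · obtain ⟨l, hl⟩ := expD_dvd (q := q) (Nat.le_of_lt_succ h)
        refine ⟨0, q ^ 3 * expN q j * l, ?_⟩
        have hDj : (expD q j : ℚ) ≠ 0 := by exact_mod_cast (expD_pos hq j).ne'
        have hl0 : (l : ℚ) ≠ 0 := by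
          rintro h
          rw [hl] at hD
          simp [h] at hD
        rw [hl, ratio]
        push_cast
        field_simp
        simpa using ratio_mul_expD hq j
      · exact ⟨1, 0, by simp⟩
      · exfalso
        refine absurd hlt (not_lt.2 (mul_le_mul_of_nonneg_left ?_ (by positivity)))
        refine le_trans ?_ (factorial_le_ratio hq j)
        exact_mod_cast Nat.factorial_le (by omega)
  | zero => exact ⟨0, 0, by simp⟩
  | add x y hx hy ihx ihy =>
    have h1 := nonneg_of_mem hq hx
    have h2 := nonneg_of_mem hq hy
    obtain ⟨c, a, rfl⟩ := ihx (by linarith)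
    obtain ⟨c', a', rfl⟩ := ihy (by linarith)
    refine ⟨c + c', a + a', ?_⟩
    push_cast
    ring

theorem int_eq_zero_of_sub_eq_mul {x y l : ℚ} {z : ℤ} (hx : 0 ≤ x) (hy : 0 ≤ y) (hxl : x < l)
    (hyl : y < l) (h : x - y = l * z) : z = 0 := by
  have hl : 0 < l := hx.trans_lt hxl
  have h1 : (z : ℚ) < 1 := by
    refine lt_of_mul_lt_mul_left ?_ hl.le
    linarith
  have h2 : (-1 : ℚ) < z := by
    refine lt_of_mul_lt_mul_left ?_ hl.le
    linarith
  have h3 : z < 1 := by exact_mod_cast h1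
  have h4 : -1 < z := by exact_mod_cast h2
  omega

set_option maxHeartbeats 1600000 in
/-- The rigidity of the monoid of exponents. -/
theorem eq_zero_and_exists_of_forall_mem (hq : 2 ≤ q) {s d : ℚ} (hs : 0 ≤ s) (hd : 0 ≤ d)
    (h : ∀ i, ratio q (i + 1) * s + d / (q : ℚ) ^ ((i + 1) * (i + 1)) ∈ expS q) :
    d = 0 ∧ ∃ c : ℕ, s = (q : ℚ) ^ 3 * c := by
  obtain ⟨i₀, hi₀⟩ := exists_nat_ge (2 * (s + d))
  obtain ⟨i, hi, hi'⟩ : ∃ i : ℕ, 2 * (s + d) ≤ i ∧ s.den ≤ i :=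
    ⟨max i₀ s.den, hi₀.trans (by exact_mod_cast le_max_left _ _), le_max_right _ _⟩
  set j := i + 1 with hj
  have hqQ : (2 : ℚ) ≤ q := by exact_mod_cast hq
  have hq1 : (1 : ℚ) ≤ q := by linarith
  have hQ : (1 : ℚ) ≤ (q : ℚ) ^ 3 := one_le_pow₀ hq1
  have hr0 := one_le_ratio hq j
  have hr1 := ratio_le hq j
  have hQj : (1 : ℚ) ≤ (q : ℚ) ^ (j * j) := one_le_pow₀ hq1
  have hdQ : d / (q : ℚ) ^ (j * j) ≤ d := div_le_self hd hQj
  have hdQ0 : 0 ≤ d / (q : ℚ) ^ (j * j) := by positivity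
  have hE : (1 : ℚ) ≤ (j + 1).factorial := by
    exact_mod_cast Nat.one_le_iff_ne_zero.2 (Nat.factorial_ne_zero _)
  have hlt : ratio q j * s + d / (q : ℚ) ^ (j * j) < (q : ℚ) ^ 3 * (i + 3).factorial := by
    have h1 : ((i + 3).factorial : ℚ) = (i + 3) * (j + 1).factorial := by
      rw [show i + 3 = (j + 1) + 1 by omega, Nat.factorial_succ (j + 1), hj]
      push_cast
      ring
    have h2 : ratio q j * s + d / (q : ℚ) ^ (j * j) ≤ (s + d) * ((j + 1).factorial + 1) := by
      nlinarith
    have h3 : (s + d) * ((j + 1).factorial + 1) ≤ i * (j + 1).factorial := by nlinarith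
    have h4 : (i : ℚ) * (j + 1).factorial < (i + 3) * (j + 1).factorial := by nlinarith
    have h5 : (0 : ℚ) ≤ (i + 3) * (j + 1).factorial := by positivity
    rw [h1]
    nlinarith
  obtain ⟨c, a, hca⟩ := exists_eq_of_mem_of_lt hq i (h i) hlt
  have hDi : (0 : ℚ) < expD q i := by exact_mod_cast expD_pos hq i
  obtain ⟨B, hB⟩ : ∃ B : ℕ, q - 1 = B := ⟨_, rfl⟩
  have hB1 : (1 : ℚ) ≤ B := by exact_mod_cast (by omega : 1 ≤ B)
  have hBq : (B : ℚ) ≤ q := by exact_mod_cast (by omega : B ≤ q)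
  have hDj : (expD q j : ℚ) = B * (q : ℚ) ^ (2 * i + 1) * expD q i := by
    rw [hj, expD_succ, hB]
    push_cast
    ring
  have hDj' : (expD q j : ℚ) = (B : ℚ) ^ j * (q : ℚ) ^ (j * j) := by
    rw [expD, hB]
    push_cast
    ring
  have hDjpos : (0 : ℚ) < expD q j := by exact_mod_cast expD_pos hq j
  have hNj : (expN q j : ℚ) = (j + 1).factorial * expD q j + 1 := by
    rw [expN]
    push_cast
    ring
  have hrD := ratio_mul_expD hq j
  have hmul : expN q j * s + (B : ℚ) ^ j * d =
      c * ((q : ℚ) ^ 3 * expN q j) + a * (B * (q : ℚ) ^ (2 * i + 1)) := by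
    have h1 : (ratio q j * s + d / (q : ℚ) ^ (j * j)) * expD q j =
        expN q j * s + (B : ℚ) ^ j * d := by
      rw [add_mul, mul_right_comm, hrD, hDj']
      field_simp
    have h2 : (c * ((q : ℚ) ^ 3 * ratio q j) + a / expD q i) * expD q j =
        c * ((q : ℚ) ^ 3 * expN q j) + a * (B * (q : ℚ) ^ (2 * i + 1)) := by
      rw [add_mul, mul_assoc, mul_assoc, hrD, hDj]
      field_simp
    rw [← h1, ← h2, hca]
  obtain ⟨z, hz⟩ : ∃ z : ℤ, ((j + 1).factorial : ℚ) * s = z := by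
    obtain ⟨l, hl⟩ := Nat.dvd_factorial s.den_pos (show s.den ≤ j + 1 by omega)
    refine ⟨l * s.num, ?_⟩
    rw [hl]
    push_cast
    have := Rat.mul_den_eq_num s
    rw [← this]
    ring
  have hfac : s + (B : ℚ) ^ j * d - c * (q : ℚ) ^ 3 = (B * (q : ℚ) ^ (2 * i + 1)) *
      ((expD q i * ((j + 1).factorial * c * q ^ 3 - z) + a : ℤ) : ℚ) := by
    push_cast
    rw [← hz]
    rw [hNj, hDj] at hmul
    linear_combination hmul
  have hiq : (i : ℚ) < (q : ℚ) ^ i := by exact_mod_cast Nat.lt_pow_self (by omega : 1 < q)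
  have hqi : (1 : ℚ) ≤ (q : ℚ) ^ i := one_le_pow₀ hq1
  have hL : (q : ℚ) ^ i * (q : ℚ) ^ i ≤ (q : ℚ) ^ (2 * i + 1) := by
    rw [← pow_add]
    exact pow_le_pow_right₀ hq1 (by omega)
  have hsd : s + d < (q : ℚ) ^ i := by linarith
  have hBi : (B : ℚ) ^ i ≤ (q : ℚ) ^ i := pow_le_pow_left₀ (by positivity) hBq i
  have hBj1 : (1 : ℚ) ≤ (B : ℚ) ^ j := one_le_pow₀ hB1
  have hup : s + (B : ℚ) ^ j * d < B * (q : ℚ) ^ (2 * i + 1) := by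
    have h1 : s + (B : ℚ) ^ j * d ≤ B * ((B : ℚ) ^ i * (s + d)) := by
      rw [← mul_assoc, mul_comm (B : ℚ), ← pow_succ]
      nlinarith
    have h2 : (B : ℚ) ^ i * (s + d) < (q : ℚ) ^ i * (q : ℚ) ^ i :=
      (mul_le_mul_of_nonneg_right hBi (by linarith)).trans_lt
        (mul_lt_mul_of_pos_left hsd (by positivity))
    nlinarith
  have hle : c * ((q : ℚ) ^ 3 * ratio q j) ≤ ratio q j * s + d / (q : ℚ) ^ (j * j) := by
    rw [hca]
    have : (0 : ℚ) ≤ a / expD q i := by positivity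
    linarith
  have hlow : c * (q : ℚ) ^ 3 < B * (q : ℚ) ^ (2 * i + 1) := by
    have h1 : c * (q : ℚ) ^ 3 ≤ s + d := by
      have h2 : ratio q j * (c * (q : ℚ) ^ 3) ≤ ratio q j * (s + d) := by nlinarith
      exact le_of_mul_le_mul_left h2 (by linarith)
    nlinarith
  have hzero : (expD q i * ((j + 1).factorial * c * q ^ 3 - z) + a : ℤ) = 0 := by
    exact int_eq_zero_of_sub_eq_mul (by positivity) (by positivity) hup hlow hfac
  rw [hzero, Int.cast_zero, mul_zero, sub_eq_zero] at hfac
  have hd0 : d = 0 := by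
    by_contra hne
    have hdpos : 0 < d := lt_of_le_of_ne hd (Ne.symm hne)
    have h1 : ratio q j * ((B : ℚ) ^ j * d) ≤ d / (q : ℚ) ^ (j * j) := by
      have h2 : ratio q j * (s + (B : ℚ) ^ j * d) = c * ((q : ℚ) ^ 3 * ratio q j) := by
        rw [hfac]
        ring
      rw [mul_add] at h2
      linarith only [h2, hle]
    rw [le_div_iff₀ (by positivity)] at h1
    have h2 : ratio q j * ((B : ℚ) ^ j * d) * (q : ℚ) ^ (j * j) = expN q j * d := by
      rw [← hrD, hDj']
      ring
    rw [h2, hNj] at h1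
    have h3 : 0 < ((j + 1).factorial : ℚ) * expD q j * d := by positivity
    linarith only [h1, h3]
  refine ⟨hd0, c, ?_⟩
  rw [hd0] at hfac
  linarith

end

end RigidExponent

namespace RigidExponent

section

variable {q : ℕ}

/-- The generators of the monoid of exponents. -/
def expGen (q i : ℕ) : expS q := ⟨(q : ℚ) ^ 3 * ratio q i, gen_mem_expS i⟩

instance : One (expS q) := ⟨⟨1, one_mem_expS⟩⟩

@[simp] theorem coe_one_expS : ((1 : expS q) : ℚ) = 1 := rfl

variable [hq : Fact (2 ≤ q)]

theorem expS_nonneg (s : expS q) : 0 ≤ s := nonneg_of_mem hq.out s.2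

instance : IsBotZeroClass (expS q) := ⟨expS_nonneg⟩

instance : WellFoundedLT (expS q) := ⟨(isPWO_expS hq.out).isWF⟩

theorem eight_le_cube : (8 : ℚ) ≤ (q : ℚ) ^ 3 := by
  have h : (2 : ℚ) ≤ q := by exact_mod_cast hq.out
  calc (8 : ℚ) = 2 ^ 3 := by norm_num
    _ ≤ (q : ℚ) ^ 3 := pow_le_pow_left₀ (by norm_num) h 3

end

variable (q : ℕ) (G : Type v)

/-- Multi-exponents, lexicographically ordered. -/
abbrev Multi : Type v := Lex (G →₀ expS q)

namespace Multi

variable {q G}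

/-- The coordinate of a multi-exponent. -/
def coord (f : Multi q G) (g : G) : ℚ := ((ofLex f) g : expS q)

theorem ext {f f' : Multi q G} (h : ∀ g, coord f g = coord f' g) : f = f' :=
  ofLex.injective (Finsupp.ext fun g => Subtype.ext (h g))

theorem coord_mem (f : Multi q G) (g : G) : coord f g ∈ expS q := ((ofLex f) g).2

@[simp] theorem coord_zero (g : G) : coord (0 : Multi q G) g = 0 := rfl

@[simp] theorem coord_add (f f' : Multi q G) (g : G) :
    coord (f + f') g = coord f g + coord f' g := rfl

@[simp] theorem coord_nsmul (n : ℕ) (f : Multi q G) (g : G) :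
    coord (n • f) g = n * coord f g := by
  induction n with
  | zero => simp
  | succ n ih => rw [succ_nsmul, coord_add, ih, Nat.cast_succ]; ring

theorem nsmul_injective {n : ℕ} (hn : n ≠ 0) {f f' : Multi q G} (h : n • f = n • f') :
    f = f' := ext fun g => by
  have := congrArg (coord · g) h
  simpa [hn] using this

/-- The multi-exponent with a single nonzero coordinate. -/
noncomputable def el (g : G) (s : expS q) : Multi q G := toLex (Finsupp.single g s)

open Classical in
theorem coord_el (g : G) (s : expS q) (a : G) : coord (el g s) a = if g = a then (s : ℚ) else 0 := by
  have h : coord (el g s) a = ((Finsupp.single g s a : expS q) : ℚ) := rfl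
  rw [h, Finsupp.single_apply]
  split_ifs <;> rfl

/-- The total degree. -/
noncomputable def deg : Multi q G →+ ℚ :=
  (expS q).subtype.comp (Finsupp.degree : (G →₀ expS q) →+ expS q)

@[simp] theorem deg_el (g : G) (s : expS q) : deg (el g s) = s :=
  congrArg Subtype.val (Finsupp.degree_single g s)

theorem deg_mem (f : Multi q G) : deg f ∈ expS q := (Finsupp.degree (ofLex f)).2

variable [hq : Fact (2 ≤ q)]

theorem coord_nonneg (f : Multi q G) (g : G) : 0 ≤ coord f g := nonneg_of_mem hq.out (coord_mem f g)

theorem deg_eq_zero {f : Multi q G} (h : deg f = 0) : f = 0 := by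
  have h1 : ∑ i ∈ (ofLex f).support, (ofLex f) i = 0 := Subtype.ext h
  rw [Finset.sum_eq_zero_iff_of_nonneg fun i _ => expS_nonneg _] at h1
  refine ofLex.injective (Finsupp.ext fun g => ?_)
  by_contra hne
  exact hne (h1 g (Finsupp.mem_support_iff.2 hne))

theorem one_le_deg {f : Multi q G} (h : f ≠ 0) : 1 ≤ deg f :=
  (zero_or_one_le_of_mem hq.out (deg_mem f)).resolve_left fun h' => h (deg_eq_zero h')

variable [LinearOrder G]

theorem exists_coord_lt {f f' : Multi q G} (h : f < f') : ∃ g, coord f g < coord f' g := by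
  obtain ⟨g, -, hg⟩ := Finsupp.Lex.lt_iff.1 h
  exact ⟨g, hg⟩

end Multi

namespace Multi

variable {q G} [Group G] [LinearOrder G]

/-- The multi-exponent recording an ordered triple of group elements. -/
noncomputable def triple (x y z : G) : Multi q G := el x 1 + 2 • el y 1 + 4 • el z 1

theorem deg_triple (x y z : G) : deg (triple x y z : Multi q G) = 7 := by
  simp only [triple, map_add, map_nsmul, deg_el, coe_one_expS]
  norm_num

theorem triple_injective {x y z x' y' z' : G}
    (h : (triple x y z : Multi q G) = triple x' y' z') : x = x' ∧ y = y' ∧ z = z' := by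
  classical
  have key : ∀ a : G, ((if x = a then 1 else 0) + 2 * (if y = a then 1 else 0) +
      4 * (if z = a then 1 else 0) : ℕ) =
      ((if x' = a then 1 else 0) + 2 * (if y' = a then 1 else 0) +
      4 * (if z' = a then 1 else 0) : ℕ) := by
    intro a
    have h1 := congrArg (coord · a) h
    simp only [triple, coord_add, coord_nsmul, coord_el, coe_one_expS] at h1
    exact_mod_cast h1
  refine ⟨?_, ?_, ?_⟩
  · have := key x
    rw [if_pos rfl] at this
    by_contra hne
    rw [if_neg (Ne.symm hne)] at this
    split_ifs at this <;> omega
  · have := key y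
    rw [if_pos (rfl : y = y)] at this
    by_contra hne
    rw [if_neg (Ne.symm hne)] at this
    split_ifs at this <;> omega
  · have := key z
    rw [if_pos (rfl : z = z)] at this
    by_contra hne
    rw [if_neg (Ne.symm hne)] at this
    split_ifs at this <;> omega

variable (q G) in
/-- The multi-exponents which are zero, or of degree at least eight, or which record an ordered
triple `(x, y, z)` with `x⁻¹ * y < x⁻¹ * z`. -/
def mon : AddSubmonoid (Multi q G) where
  carrier := {f | f = 0 ∨ 8 ≤ deg f ∨ ∃ x y z : G, x⁻¹ * y < x⁻¹ * z ∧ f = triple x y z}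
  zero_mem' := Or.inl rfl
  add_mem' := by
    have key : ∀ {f : Multi q G}, (8 ≤ deg f ∨ ∃ x y z : G, x⁻¹ * y < x⁻¹ * z ∧
        f = triple x y z) → 7 ≤ deg f := by
      rintro f (h | ⟨x, y, z, -, rfl⟩)
      · linarith
      · rw [deg_triple]
    rintro a b (rfl | ha) hb
    · rwa [zero_add]
    · rcases hb with rfl | hb
      · rw [add_zero]
        exact Or.inr ha
      · refine Or.inr (Or.inl ?_)
        rw [map_add]
        linarith [key ha, key hb]

theorem mem_mon_of_eight_le {f : Multi q G} (h : 8 ≤ deg f) : f ∈ mon q G := Or.inr (Or.inl h)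

theorem triple_mem_mon {x y z : G} : (triple x y z : Multi q G) ∈ mon q G ↔ x⁻¹ * y < x⁻¹ * z := by
  constructor
  · rintro (h | h | ⟨x', y', z', h, e⟩)
    · have := congrArg deg h
      rw [deg_triple, map_zero] at this
      norm_num at this
    · rw [deg_triple] at h
      norm_num at h
    · obtain ⟨rfl, rfl, rfl⟩ := triple_injective e
      exact h
  · exact fun h => Or.inr (Or.inr ⟨x, y, z, h, rfl⟩)

/-- Translation of multi-exponents by a group element. -/
noncomputable def shift (g : G) : Multi q G ≃+ Multi q G :=
  (Finsupp.domCongr (Equiv.mulLeft g) : (G →₀ expS q) ≃+ (G →₀ expS q))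

theorem coord_shift (g : G) (f : Multi q G) (a : G) : coord (shift g f) a = coord f (g⁻¹ * a) :=
  rfl

theorem shift_el (g a : G) (s : expS q) : shift g (el a s) = el (g * a) s :=
  Finsupp.equivMapDomain_single (Equiv.mulLeft g) a s

theorem deg_shift (g : G) (f : Multi q G) : deg (shift g f) = deg f := by
  refine congrArg Subtype.val ?_
  have h : shift g f = (ofLex f).mapDomain (Equiv.mulLeft g) :=
    Finsupp.equivMapDomain_eq_mapDomain _ _
  exact (congrArg Finsupp.degree h).trans (Finsupp.degree_mapDomain _ _)

theorem shift_mem_mon (g : G) {f : Multi q G} (hf : f ∈ mon q G) : shift g f ∈ mon q G := by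
  rcases hf with rfl | h | ⟨x, y, z, h, rfl⟩
  · rw [map_zero]
    exact zero_mem _
  · exact mem_mon_of_eight_le (by rwa [deg_shift])
  · have e : shift g (triple x y z : Multi q G) = triple (g * x) (g * y) (g * z) := by
      simp only [triple, map_add, map_nsmul, shift_el]
    rw [e, triple_mem_mon]
    simpa [mul_assoc] using h

theorem shift_mul (g h : G) (f : Multi q G) : shift (g * h) f = shift g (shift h f) :=
  ext fun a => by simp [coord_shift, mul_assoc]

theorem shift_one (f : Multi q G) : shift 1 f = f := ext fun a => by simp [coord_shift]

/-- Translation, on the monoid. -/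
noncomputable def monShift (g : G) : mon q G ≃+ mon q G where
  toFun m := ⟨shift g m, shift_mem_mon g m.2⟩
  invFun m := ⟨shift g⁻¹ m, shift_mem_mon g⁻¹ m.2⟩
  left_inv m := Subtype.ext (by
    change shift g⁻¹ (shift g (m : Multi q G)) = m
    rw [← shift_mul, inv_mul_cancel, shift_one])
  right_inv m := Subtype.ext (by
    change shift g (shift g⁻¹ (m : Multi q G)) = m
    rw [← shift_mul, mul_inv_cancel, shift_one])
  map_add' m m' := Subtype.ext (map_add _ _ _)

variable [hq : Fact (2 ≤ q)]

/-- Multiplication by the cube of `q`, as a map into the monoid. -/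
noncomputable def mulQ : Multi q G →+ mon q G where
  toFun f := ⟨q ^ 3 • f, by
    rcases eq_or_ne f 0 with rfl | hf
    · have h : q ^ 3 • (0 : Multi q G) = 0 := smul_zero _
      rw [h]
      exact zero_mem _
    · refine mem_mon_of_eight_le ?_
      rw [map_nsmul, nsmul_eq_mul]
      push_cast
      have h1 := one_le_deg hf
      have h2 := eight_le_cube (q := q)
      nlinarith⟩
  map_zero' := Subtype.ext (smul_zero _)
  map_add' f f' := Subtype.ext (smul_add _ _ _)

theorem coe_mulQ (f : Multi q G) : (mulQ f : Multi q G) = q ^ 3 • f := rfl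

theorem cube_ne_zero : q ^ 3 ≠ 0 := pow_ne_zero _ (by have := hq.out; omega)

theorem mulQ_injective : Function.Injective (mulQ : Multi q G → mon q G) := fun _ _ h =>
  nsmul_injective cube_ne_zero (congrArg Subtype.val h)

theorem mulQ_coe (m : mon q G) : mulQ (m : Multi q G) = q ^ 3 • m := rfl

/-- The embedding of the free commutative monoid on the group. -/
noncomputable def free : (G →₀ ℕ) →+ mon q G :=
  mulQ.comp (Finsupp.mapRange.addMonoidHom (multiplesHom (expS q) 1))

theorem coord_free (l : G →₀ ℕ) (g : G) : coord ((free l : mon q G) : Multi q G) g = (q : ℚ) ^ 3 * l g := by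
  have h : ((free l : mon q G) : Multi q G) = q ^ 3 • (toLex (l.mapRange (multiplesHom (expS q) 1)
    (map_zero _)) : Multi q G) := rfl
  have h1 : coord (toLex (l.mapRange (multiplesHom (expS q) 1) (map_zero _)) : Multi q G) g =
      ((l g • (1 : expS q) : expS q) : ℚ) := rfl
  rw [h, coord_nsmul, h1]
  simp

theorem free_single (g : G) : (free (Finsupp.single g 1) : mon q G) = mulQ (el g 1) := by
  classical
  refine Subtype.ext (ext fun a => ?_)
  rw [coord_free, coe_mulQ, coord_nsmul, coord_el, Finsupp.single_apply]
  split_ifs <;> simp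

theorem free_injective : Function.Injective (free : (G →₀ ℕ) → mon q G) := fun l l' h =>
  Finsupp.ext fun g => by
    have h1 := congrArg (fun m : mon q G => coord (m : Multi q G) g) h
    simp only [coord_free] at h1
    have h2 : (q : ℚ) ^ 3 ≠ 0 := by exact_mod_cast cube_ne_zero (q := q)
    exact_mod_cast mul_left_cancel₀ h2 h1

theorem exists_eq_free {m : mon q G}
    (h : ∀ g, ∃ c : ℕ, coord (m : Multi q G) g = (q : ℚ) ^ 3 * c) : ∃ l, m = free l := by
  choose c hc using h
  refine ⟨Finsupp.onFinset (ofLex (m : Multi q G)).support c fun g hg => ?_, ?_⟩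
  · rw [Finsupp.mem_support_iff]
    intro h0
    have h1 : coord (m : Multi q G) g = 0 := congrArg Subtype.val h0
    rw [hc] at h1
    have h2 : (q : ℚ) ^ 3 ≠ 0 := by exact_mod_cast cube_ne_zero (q := q)
    exact hg (by exact_mod_cast (mul_eq_zero.1 h1).resolve_left h2)
  · refine Subtype.ext (ext fun g => ?_)
    rw [coord_free, hc, Finsupp.onFinset_apply]

/-- The elements attached to the generators of the monoid of exponents. -/
noncomputable def gen (i : ℕ) (g : G) : mon q G :=
  ⟨el g (expGen q i), mem_mon_of_eight_le (by
    rw [deg_el]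
    change (8 : ℚ) ≤ (q : ℚ) ^ 3 * ratio q i
    have h1 := one_le_ratio hq.out i
    have h2 := eight_le_cube (q := q)
    nlinarith)⟩

variable [WellFoundedGT G]

instance : WellFoundedLT (mon q G) :=
  ⟨InvImage.wf (Subtype.val : mon q G → Multi q G) wellFounded_lt⟩

noncomputable instance : Finset.HasAntidiagonal (mon q G) where
  antidiagonal m := Finset.antidiagonal (Set.isPWO_of_wellQuasiOrderedLE Set.univ)
    (Set.isPWO_of_wellQuasiOrderedLE Set.univ) m
  mem_antidiagonal := by simp

end Multi

end RigidExponent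

namespace RigidExponent

open Multi HahnSeries

section Rigid

variable {q : ℕ} [hq : Fact (2 ≤ q)] {G : Type v} [Group G] [LinearOrder G] [WellFoundedGT G]
  {k : Type u} [Field k]

/-- A series all of whose powers with exponents `expN q (i + 1)` have roots of order
`expD q (i + 1)`. -/
def IsRigid (q : ℕ) {A : Type*} [Monoid A] (y : A) : Prop :=
  ∀ i, ∃ u, u ^ expD q (i + 1) = y ^ expN q (i + 1)

theorem IsRigid.map {A B F : Type*} [Monoid A] [Monoid B] [FunLike F A B] [MonoidHomClass F A B]
    {y : A} (hy : IsRigid q y) (φ : F) : IsRigid q (φ y) := fun i => by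
  obtain ⟨u, hu⟩ := hy i
  exact ⟨φ u, by rw [← map_pow, hu, map_pow]⟩

/-- The coordinates, as homomorphisms on the monoid. -/
def monCoord (g : G) : mon q G →+ ℚ where
  toFun m := coord (m : Multi q G) g
  map_zero' := rfl
  map_add' _ _ := rfl

/-- The monomial with a given exponent. -/
noncomputable def mono (k : Type u) [Field k] (m : mon q G) : HahnSeries (mon q G) k := single m 1

theorem mono_injective : Function.Injective (mono k : mon q G → _) := fun a b h => by
  have h1 := congrArg order h
  rwa [mono, mono, order_single one_ne_zero, order_single one_ne_zero] at h1

theorem mono_add (a b : mon q G) : mono k (a + b) = mono k a * mono k b := by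
  rw [mono, mono, mono, single_mul_single, one_mul]

theorem mono_nsmul (n : ℕ) (a : mon q G) : mono k (n • a) = mono k a ^ n := by
  rw [mono, mono, single_pow, one_pow]

theorem mono_zero : mono k (0 : mon q G) = 1 := rfl

theorem mono_ne_zero (a : mon q G) : mono k a ≠ 0 := single_ne_zero one_ne_zero

theorem order_mono (a : mon q G) : (mono k a).order = a := order_single one_ne_zero

theorem eq_single_of_tail_eq_zero {y : HahnSeries (mon q G) k} (h : y.tail = 0) :
    y = single y.order y.leadingCoeff := by
  conv_lhs => rw [← single_add_tail y, h, add_zero]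

theorem pow_expD_eq_one [Fintype k] (hcard : Fintype.card k = q) {c : k} (hc : c ≠ 0) (i : ℕ) :
    c ^ expD q (i + 1) = 1 := by
  obtain ⟨t, ht⟩ : q - 1 ∣ expD q (i + 1) :=
    (dvd_pow_self _ (Nat.succ_ne_zero i)).mul_right _
  rw [ht, pow_mul, ← hcard, FiniteField.pow_card_sub_one_eq_one c hc, one_pow]

theorem leadingCoeff_eq_one [Fintype k] (hcard : Fintype.card k = q) {y u : HahnSeries (mon q G) k}
    (hy : y ≠ 0) {i : ℕ} (hu : u ^ expD q (i + 1) = y ^ expN q (i + 1)) :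
    y.leadingCoeff = 1 := by
  have h := congrArg leadingCoeff hu
  have hu0 : u ≠ 0 := by
    rintro rfl
    rw [zero_pow (expD_pos hq.out _).ne'] at hu
    exact pow_ne_zero _ hy hu.symm
  rw [leadingCoeff_pow', leadingCoeff_pow',
    pow_expD_eq_one hcard (leadingCoeff_ne_zero.2 hu0), expN, pow_succ, mul_comm _ (expD q (i + 1)),
    pow_mul, pow_expD_eq_one hcard (leadingCoeff_ne_zero.2 hy), one_pow, one_mul] at h
  exact h.symm

theorem coord_order_eq {y u : HahnSeries (mon q G) k}
    {i : ℕ} (hu : u ^ expD q (i + 1) = y ^ expN q (i + 1)) (g : G) :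
    coord (u.order : Multi q G) g = ratio q (i + 1) * coord (y.order : Multi q G) g := by
  have h := congrArg (fun z => monCoord g z.order) hu
  simp only [order_pow, map_nsmul, nsmul_eq_mul] at h
  have hD : (expD q (i + 1) : ℚ) ≠ 0 := by exact_mod_cast (expD_pos hq.out _).ne'
  rw [← ratio_mul_expD hq.out, mul_right_comm, mul_comm] at h
  exact mul_right_cancel₀ hD h

variable {p f : ℕ} [Fact p.Prime] [CharP k p]

instance : CharP (HahnSeries (mon q G) k) p := charP_of_injective_ringHom C_injective p

theorem exponent_ne_zero (hqp : q = p ^ f) : f ≠ 0 := by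
  rintro rfl
  have := hq.out
  rw [hqp, pow_zero] at this
  omega

theorem cast_q_eq_zero (hqp : q = p ^ f) : (q : k) = 0 := by
  rw [hqp, Nat.cast_pow, CharP.cast_eq_zero, zero_pow (exponent_ne_zero hqp)]

theorem cast_sub_one_pow_ne_zero (hqp : q = p ^ f) (i : ℕ) : (((q - 1) ^ i : ℕ) : k) ≠ 0 := by
  have h1 : 1 ≤ q := by have := hq.out; omega
  rw [Nat.cast_pow, Nat.cast_sub h1, cast_q_eq_zero hqp]
  simp

theorem cast_expN_ne_zero (hqp : q = p ^ f) (i : ℕ) : (expN q (i + 1) : k) ≠ 0 := by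
  rw [expN, expD]
  push_cast
  rw [cast_q_eq_zero hqp]
  simp

theorem expD_eq (hqp : q = p ^ f) (i : ℕ) : expD q i = (q - 1) ^ i * p ^ (f * (i * i)) := by
  rw [expD, pow_mul p, ← hqp]

/-- If the `expD`-th power of a series has a single term, then so does the series. -/
theorem tail_eq_zero_of_pow (hqp : q = p ^ f) {u : HahnSeries (mon q G) k} {i : ℕ}
    (hu : (u ^ expD q i).tail = 0) : u.tail = 0 := by
  by_contra hne
  rw [expD_eq hqp] at hu
  exact (order_tail_pow p hne (cast_sub_one_pow_ne_zero hqp i) _).1 hu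

theorem coord_order_tail_eq (hqp : q = p ^ f) {y u : HahnSeries (mon q G) k} (hy : y.tail ≠ 0)
    {i : ℕ} (hu : u ^ expD q (i + 1) = y ^ expN q (i + 1)) (g : G) :
    coord (u.tail.order : Multi q G) g = ratio q (i + 1) * coord (y.order : Multi q G) g +
      (coord (y.tail.order : Multi q G) g - coord (y.order : Multi q G) g) /
        (q : ℚ) ^ ((i + 1) * (i + 1)) := by
  have h1 := order_tail_pow p hy (cast_expN_ne_zero (k := k) hqp i) 0
  simp only [pow_zero, mul_one, one_smul] at h1
  have hut : u.tail ≠ 0 := by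
    intro h0
    have h2 := eq_single_of_tail_eq_zero h0
    refine h1.1 ?_
    rw [← hu, h2, single_pow, tail_single]
  have h2 := order_tail_pow p hut (cast_sub_one_pow_ne_zero (k := k) hqp (i + 1))
    (f * ((i + 1) * (i + 1)))
  rw [← expD_eq hqp, hu] at h2
  have hQ : p ^ (f * ((i + 1) * (i + 1))) = q ^ ((i + 1) * (i + 1)) := by rw [hqp, pow_mul]
  rw [hQ] at h2
  have e1 := congrArg (monCoord g) h1.2
  have e2 := congrArg (monCoord g) h2.2
  have e3 := congrArg (fun z => monCoord g z.order) hu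
  simp only [order_pow, map_add, map_nsmul, nsmul_eq_mul] at e1 e2 e3
  rw [← coord_order_eq hu g]
  push_cast at e1 e2 e3
  have hQ0 : (q : ℚ) ^ ((i + 1) * (i + 1)) ≠ 0 :=
    pow_ne_zero _ (by have := hq.out; exact_mod_cast (by omega : q ≠ 0))
  rw [add_div' _ _ _ hQ0, eq_div_iff hQ0]
  change monCoord g _ * _ = monCoord g _ * _ + (monCoord g _ - monCoord g _)
  linarith

variable [Fintype k]

theorem IsRigid.exists_eq_free (hqp : q = p ^ f) (hcard : Fintype.card k = q)
    {y : HahnSeries (mon q G) k} (hy : y ≠ 0) (hr : IsRigid q y) : ∃ l, y = mono k (free l) := by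
  have ht : y.tail = 0 := by
    by_contra ht
    obtain ⟨g, hg⟩ := exists_coord_lt (Subtype.coe_lt_coe.2 (order_lt_order_tail ht))
    have h := eq_zero_and_exists_of_forall_mem hq.out (coord_nonneg (y.order : Multi q G) g)
      (sub_nonneg.2 hg.le) fun i => by
        obtain ⟨u, hu⟩ := hr i
        rw [← coord_order_tail_eq hqp ht hu g]
        exact coord_mem _ _
    linarith [h.1]
  obtain ⟨l, hl⟩ := Multi.exists_eq_free (m := y.order) fun g =>
    (eq_zero_and_exists_of_forall_mem hq.out (coord_nonneg (y.order : Multi q G) g) le_rfl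
      fun i => by
        obtain ⟨u, hu⟩ := hr i
        rw [zero_div, add_zero, ← coord_order_eq hu g]
        exact coord_mem _ _).2
  obtain ⟨u, hu⟩ := hr 0
  refine ⟨l, ?_⟩
  rw [mono, ← hl, ← leadingCoeff_eq_one hcard hy hu]
  exact eq_single_of_tail_eq_zero ht

theorem expD_nsmul_gen (i : ℕ) (g : G) :
    expD q i • gen i g = expN q i • (mulQ (el g 1) : mon q G) := by
  classical
  refine Subtype.ext (Multi.ext fun a => ?_)
  change monCoord a (expD q i • gen i g) = monCoord a (expN q i • mulQ (el g 1))
  rw [map_nsmul, map_nsmul]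
  change _ • coord (el g (expGen q i)) a = _ • coord (q ^ 3 • el g 1) a
  rw [coord_nsmul, nsmul_eq_mul, nsmul_eq_mul, coord_el, coord_el]
  split_ifs
  · have h2 : ((expGen q i : expS q) : ℚ) = (q : ℚ) ^ 3 * ratio q i := rfl
    rw [h2, coe_one_expS, ← ratio_mul_expD hq.out]
    push_cast
    ring
  · simp

theorem isRigid_free (l : G →₀ ℕ) : IsRigid q (mono k (free l : mon q G)) := fun i => by
  obtain ⟨w, hw⟩ : ∃ w, expD q (i + 1) • w = expN q (i + 1) • (free l : mon q G) := by
    induction l using Finsupp.induction_linear with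
    | zero => exact ⟨0, by simp⟩
    | add l l' h h' =>
      obtain ⟨w, hw⟩ := h
      obtain ⟨w', hw'⟩ := h'
      exact ⟨w + w', by rw [nsmul_add, hw, hw', map_add, nsmul_add]⟩
    | single g n =>
      refine ⟨n • gen (i + 1) g, ?_⟩
      have h1 : Finsupp.single g n = n • Finsupp.single g 1 := by simp
      rw [h1, map_nsmul, free_single, smul_comm, expD_nsmul_gen, smul_comm]
  exact ⟨mono k w, by rw [← mono_nsmul, hw, mono_nsmul]⟩

end Rigid

end RigidExponent

namespace RigidExponent

open Multi HahnSeries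

section Automorphism

variable {q : ℕ} [hq : Fact (2 ≤ q)] {G : Type v} [Group G] [LinearOrder G] [WellFoundedGT G]
  {k : Type u} [Field k]

/-- The variable indexed by an element of the group. -/
noncomputable def var (q : ℕ) [Fact (2 ≤ q)] (k : Type u) [Field k] (g : G) :
    HahnSeries (mon q G) k := mono k (mulQ (el g 1))

theorem el_one_injective : Function.Injective fun g : G => (el g 1 : Multi q G) := fun g h e => by
  classical
  have h1 := congrArg (coord · g) e
  simp only [coord_el, coe_one_expS, if_true] at h1
  by_contra hne
  rw [if_neg (Ne.symm hne)] at h1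
  exact one_ne_zero h1

theorem var_injective : Function.Injective (var q k : G → _) := fun _ _ h =>
  el_one_injective (mulQ_injective (mono_injective h))

theorem mono_mulQ_triple (x y z : G) : mono k (mulQ (triple x y z) : mon q G) =
    var q k x * var q k y ^ 2 * var q k z ^ 4 := by
  simp only [var, triple, map_add, map_nsmul, mono_add, mono_nsmul]

theorem triple_mem_mon_of_pow_eq {v : HahnSeries (mon q G) k} {x y z : G}
    (h : v ^ q ^ 3 = var q k x * var q k y ^ 2 * var q k z ^ 4) :
    (triple x y z : Multi q G) ∈ mon q G := by
  rw [← mono_mulQ_triple] at h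
  have h1 := congrArg order h
  rw [order_pow, order_mono, ← mulQ_coe] at h1
  rw [← mulQ_injective h1]
  exact v.order.2

variable {p f : ℕ} [Fact p.Prime] [CharP k p] [Fintype k]

theorem exists_free_map (hqp : q = p ^ f) (hcard : Fintype.card k = q)
    (φ : HahnSeries (mon q G) k ≃+* HahnSeries (mon q G) k) :
    ∃ F : (G →₀ ℕ) →+ (G →₀ ℕ), ∀ l, φ (mono k (free l)) = mono k (free (F l)) := by
  have h : ∀ l, ∃ l', φ (mono k (free l)) = mono k (free l') := fun l =>
    ((isRigid_free l).map φ).exists_eq_free hqp hcard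
      ((map_ne_zero_iff φ φ.injective).2 (mono_ne_zero _))
  choose F hF using h
  have hadd : ∀ a b, F (a + b) = F a + F b := fun a b =>
    free_injective (mono_injective (k := k) (by
      rw [← hF, map_add, map_add, mono_add, mono_add, map_mul, hF, hF]))
  have hzero : F 0 = 0 := by simpa using hadd 0 0
  exact ⟨⟨⟨F, hzero⟩, hadd⟩, hF⟩

theorem exists_map_var (hqp : q = p ^ f) (hcard : Fintype.card k = q)
    (φ : HahnSeries (mon q G) k ≃+* HahnSeries (mon q G) k) :
    ∃ π : G → G, ∀ g, φ (var q k g) = var q k (π g) := by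
  obtain ⟨F, hF⟩ := exists_free_map hqp hcard φ
  obtain ⟨F', hF'⟩ := exists_free_map hqp hcard φ.symm
  have hFF : ∀ l, F' (F l) = l := fun l => free_injective (mono_injective (k := k) (by
    rw [← hF', ← hF, φ.symm_apply_apply]))
  have hFF' : ∀ l, F (F' l) = l := fun l => free_injective (mono_injective (k := k) (by
    rw [← hF, ← hF', φ.apply_symm_apply]))
  have key : ∀ g, ∃ h, F (Finsupp.single g 1) = Finsupp.single h 1 := by
    intro g
    have h0 : F (Finsupp.single g 1) ≠ 0 := fun h => by
      have := hFF (Finsupp.single g 1)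
      rw [h, map_zero, eq_comm, Finsupp.single_eq_zero] at this
      omega
    obtain ⟨h, hh⟩ := Finsupp.ne_iff.1 h0
    refine ⟨h, ?_⟩
    have hle : Finsupp.single h 1 ≤ F (Finsupp.single g 1) :=
      Finsupp.single_le_iff.2 (Nat.one_le_iff_ne_zero.2 hh)
    obtain ⟨r, hr⟩ := exists_add_of_le hle
    have h1 := congrArg F' hr
    rw [hFF, map_add] at h1
    have h2 := congrArg Finsupp.degree h1
    rw [map_add, Finsupp.degree_single] at h2
    have h3 : F' (Finsupp.single h 1) ≠ 0 := fun h' => by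
      have := hFF' (Finsupp.single h 1)
      rw [h', map_zero, eq_comm, Finsupp.single_eq_zero] at this
      omega
    have h4 : Finsupp.degree (F' (Finsupp.single h 1)) ≠ 0 := fun h => h3
      ((Finsupp.degree_eq_zero_iff _).1 h)
    have h5 : Finsupp.degree (F' r) = 0 := by omega
    have h6 : r = 0 := by
      rw [← hFF' r, (Finsupp.degree_eq_zero_iff _).1 h5, map_zero]
    rw [hr, h6, add_zero]
  choose π hπ using key
  refine ⟨π, fun g => ?_⟩
  rw [var, var, ← free_single, ← free_single, hF, hπ]

theorem exists_map_var_eq_mul (hqp : q = p ^ f) (hcard : Fintype.card k = q)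
    (φ : HahnSeries (mon q G) k ≃+* HahnSeries (mon q G) k) :
    ∃ c : G, ∀ g, φ (var q k g) = var q k (c * g) := by
  obtain ⟨π, hπ⟩ := exists_map_var hqp hcard φ
  obtain ⟨π', hπ'⟩ := exists_map_var hqp hcard φ.symm
  have hlt : ∀ x y z, x⁻¹ * y < x⁻¹ * z → (π x)⁻¹ * π y < (π x)⁻¹ * π z := by
    intro x y z h
    rw [← triple_mem_mon (q := q)] at h ⊢
    refine triple_mem_mon_of_pow_eq (k := k) (v := φ (mono k ⟨_, h⟩)) ?_
    have e : q ^ 3 • (⟨_, h⟩ : mon q G) = mulQ (triple x y z) := rfl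
    rw [← map_pow, ← mono_nsmul, ← mulQ_coe, mono_mulQ_triple, map_mul, map_mul, map_pow, map_pow,
      hπ, hπ, hπ]
  have hmono : StrictMono fun a => (π 1)⁻¹ * π a := fun a b hab => hlt 1 a b (by simpa using hab)
  have hsurj : Function.Surjective fun a => (π 1)⁻¹ * π a := fun b =>
    ⟨π' (π 1 * b), by
      have h : π (π' (π 1 * b)) = π 1 * b := var_injective (q := q) (k := k) (by
        rw [← hπ, ← hπ', φ.apply_symm_apply])
      simp only [h, inv_mul_cancel_left]⟩
  refine ⟨π 1, fun g => ?_⟩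
  have h := DFunLike.congr_fun
    (Subsingleton.elim (hmono.orderIsoOfSurjective _ hsurj) (OrderIso.refl G)) g
  have h1 : (π 1)⁻¹ * π g = g := h
  rw [hπ, inv_mul_eq_iff_eq_mul.1 h1]

theorem nsmul_gen_eq (i : ℕ) (g : G) : ∃ n : ℕ, ((q - 1) * q ^ (2 * i + 1)) • (gen (i + 1) g : mon q G) =
    (gen i g + n • mulQ (el g 1) : mon q G) := by
  classical
  have h1 : 1 ≤ q := by have := hq.out; omega
  set L := (q - 1) * q ^ (2 * i + 1) with hL
  have hL1 : 1 ≤ L := Nat.mul_pos (by have := hq.out; omega) (Nat.pow_pos h1)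
  obtain ⟨n, hn⟩ : ∃ n, L * (i + 2).factorial = (i + 1).factorial + n :=
    exists_add_of_le ((Nat.factorial_le (by omega)).trans (Nat.le_mul_of_pos_left _ hL1))
  refine ⟨n, Subtype.ext (Multi.ext fun a => ?_)⟩
  change monCoord a (L • gen (i + 1) g) = monCoord a (gen i g + n • mulQ (el g 1))
  rw [map_add, map_nsmul, map_nsmul]
  change _ • coord (el g (expGen q (i + 1))) a =
    coord (el g (expGen q i)) a + _ • coord (q ^ 3 • el g 1) a
  rw [coord_nsmul, nsmul_eq_mul, nsmul_eq_mul, coord_el, coord_el, coord_el]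
  split_ifs
  · have h2 : ∀ j, ((expGen q j : expS q) : ℚ) = (q : ℚ) ^ 3 * ratio q j := fun _ => rfl
    have hD : ((expD q i : ℕ) : ℚ) ≠ 0 := by exact_mod_cast (expD_pos hq.out i).ne'
    have hLQ : (L : ℚ) ≠ 0 := by exact_mod_cast (by omega : L ≠ 0)
    have hn' : (L : ℚ) * (i + 2).factorial = (i + 1).factorial + n := by exact_mod_cast hn
    have h3 : (L : ℚ) * ratio q (i + 1) = ratio q i + n := by
      rw [ratio, ratio, expN, expN, expD_succ, ← hL]
      push_cast
      field_simp
      linear_combination (expD q i : ℚ) * hn'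
    rw [h2, h2, coe_one_expS]
    push_cast
    linear_combination (q : ℚ) ^ 3 * h3
  · simp

theorem map_gen (hqp : q = p ^ f) (hcard : Fintype.card k = q)
    (φ : HahnSeries (mon q G) k ≃+* HahnSeries (mon q G) k)
    (hφ : ∀ g, φ (var q k g) = var q k g) (i : ℕ) (g : G) :
    φ (mono k (gen i g)) = mono k (gen i g) := by
  set u := φ (mono k (gen (i + 1) g)) with hu
  have h1 : u ^ expD q (i + 1) = mono k (expD q (i + 1) • gen (i + 1) g) := by
    rw [hu, ← map_pow, ← mono_nsmul, expD_nsmul_gen, mono_nsmul]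
    change φ (var q k g ^ _) = _
    rw [map_pow, hφ]
    rfl
  have h2 : u.tail = 0 := tail_eq_zero_of_pow hqp (i := i + 1) (by
    rw [h1, mono, tail_single])
  have h3 : u.order = gen (i + 1) g := by
    have h := congrArg order h1
    rw [order_pow, order_mono] at h
    refine Subtype.ext (nsmul_injective (expD_pos hq.out (i + 1)).ne' ?_)
    exact congrArg Subtype.val h
  have h4 : u.leadingCoeff ≠ 0 := leadingCoeff_ne_zero.2
    ((map_ne_zero_iff φ φ.injective).2 (mono_ne_zero _))
  obtain ⟨n, hn⟩ := nsmul_gen_eq (q := q) i g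
  have h5 : u ^ ((q - 1) * q ^ (2 * i + 1)) =
      mono k (((q - 1) * q ^ (2 * i + 1)) • gen (i + 1) g) := by
    have h6 := FiniteField.pow_card_sub_one_eq_one _ h4
    rw [hcard] at h6
    rw [eq_single_of_tail_eq_zero h2, single_pow, h3, pow_mul, h6, one_pow]
    rfl
  rw [hn, hu, ← map_pow, ← mono_nsmul, hn, mono_add, map_mul, mono_nsmul] at h5
  change _ * φ (var q k g ^ n) = _ * var q k g ^ n at h5
  rw [map_pow, hφ] at h5
  exact mul_right_cancel₀ (pow_ne_zero _ (mono_ne_zero _)) h5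

theorem map_mono_mulQ (hqp : q = p ^ f) (hcard : Fintype.card k = q)
    (φ : HahnSeries (mon q G) k ≃+* HahnSeries (mon q G) k)
    (hφ : ∀ g, φ (var q k g) = var q k g) (m : Multi q G) :
    φ (mono k (mulQ m)) = mono k (mulQ m) := by
  have hadd : ∀ a b : Multi q G, φ (mono k (mulQ a)) = mono k (mulQ a) →
      φ (mono k (mulQ b)) = mono k (mulQ b) → φ (mono k (mulQ (a + b))) = mono k (mulQ (a + b)) :=
    fun a b ha hb => by rw [map_add, mono_add, map_mul, ha, hb]
  have hzero : φ (mono k (mulQ (0 : Multi q G))) = mono k (mulQ 0) := by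
    rw [map_zero, mono_zero, map_one]
  have key : ∀ (g : G) (s : ℚ) (hs : s ∈ expS q),
      φ (mono k (mulQ (el g ⟨s, hs⟩))) = mono k (mulQ (el g ⟨s, hs⟩)) := by
    intro g s hs
    refine AddSubmonoid.closure_induction (motive := fun s hs =>
      φ (mono k (mulQ (el g ⟨s, hs⟩))) = mono k (mulQ (el g ⟨s, hs⟩))) ?_ ?_ ?_ hs
    · rintro s (rfl | ⟨i, rfl⟩)
      · exact hφ g
      · change φ (mono k (q ^ 3 • gen i g)) = mono k (q ^ 3 • gen i g)
        rw [mono_nsmul, map_pow, map_gen hqp hcard φ hφ]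
    · have h : (el g ⟨0, zero_mem _⟩ : Multi q G) = 0 := congrArg toLex (Finsupp.single_zero g)
      rw [h]
      exact hzero
    · intro x y hx hy h1 h2
      have h : (el g ⟨x + y, add_mem hx hy⟩ : Multi q G) = el g ⟨x, hx⟩ + el g ⟨y, hy⟩ :=
        congrArg toLex (Finsupp.single_add g (⟨x, hx⟩ : expS q) ⟨y, hy⟩)
      rw [h]
      exact hadd _ _ h1 h2
  refine Finsupp.induction_linear (motive := fun m : G →₀ expS q =>
      φ (mono k (mulQ (toLex m))) = mono k (mulQ (toLex m))) (ofLex m) hzero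
    (fun a b ha hb => hadd _ _ ha hb) fun g s => key g s s.2

theorem map_mono (hqp : q = p ^ f) (hcard : Fintype.card k = q)
    (φ : HahnSeries (mon q G) k ≃+* HahnSeries (mon q G) k)
    (hφ : ∀ g, φ (var q k g) = var q k g) (m : mon q G) : φ (mono k m) = mono k m := by
  have h := map_mono_mulQ hqp hcard φ hφ m
  rw [mulQ_coe, mono_nsmul, map_pow, ← sub_eq_zero] at h
  have hq3 : q ^ 3 = p ^ (f * 3) := by rw [pow_mul, ← hqp]
  rw [hq3, ← sub_pow_char_pow] at h
  exact sub_eq_zero.1 (eq_zero_of_pow_eq_zero h)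

end Automorphism

end RigidExponent

namespace RigidExponent

open Multi HahnSeries DecompCoalg

section Action

variable {q : ℕ} [hq : Fact (2 ≤ q)] {G : Type v} [Group G] [LinearOrder G] [WellFoundedGT G]
  {k : Type u} [Field k]

theorem monShift_mul (g h : G) (m : mon q G) : monShift (g * h) m = monShift g (monShift h m) :=
  Subtype.ext (shift_mul g h _)

theorem monShift_injective : Function.Injective (monShift : G → mon q G ≃+ mon q G) := by
  intro g h hgh
  have h1 : monShift g (mulQ (el 1 1)) = (monShift h (mulQ (el 1 1)) : mon q G) := by rw [hgh]
  have h2 := congrArg Subtype.val h1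
  change shift g (q ^ 3 • el 1 1) = (shift h (q ^ 3 • el 1 1) : Multi q G) at h2
  rw [map_nsmul, map_nsmul, shift_el, shift_el, mul_one, mul_one] at h2
  exact el_one_injective (nsmul_injective cube_ne_zero h2)

/-- The transpose of a coalgebra automorphism, as an automorphism of the Hahn series ring. -/
noncomputable def transposeEquiv (f : coalgAut k (DecompCoalg k (mon q G))) :
    HahnSeries (mon q G) k ≃+* HahnSeries (mon q G) k :=
  RingEquiv.ofRingHom (transpose f) (transpose f⁻¹) (RingHom.ext (transpose_apply_inv f))
    (RingHom.ext (transpose_inv_apply f))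

theorem transposeEquiv_apply (f : coalgAut k (DecompCoalg k (mon q G)))
    (y : HahnSeries (mon q G) k) : transposeEquiv f y = transpose f y := rfl

variable {p e : ℕ} [Fact p.Prime] [CharP k p] [Fintype k]

theorem exists_injective_coalgAut_hom (hqp : q = p ^ e) (hcard : Fintype.card k = q) :
    ∃ γ : coalgAut k (DecompCoalg k (mon q G)) →* G, Function.Injective γ := by
  choose c hc using fun f : coalgAut k (DecompCoalg k (mon q G)) =>
    exists_map_var_eq_mul hqp hcard (transposeEquiv f)
  simp only [transposeEquiv_apply] at hc
  have hmul : ∀ f h, c (f * h) = c h * c f := fun f h =>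
    mul_right_cancel (b := 1) (var_injective (q := q) (k := k) (by
      rw [← hc, transpose_mul, hc, hc, mul_assoc]))
  refine ⟨MonoidHom.mk' (fun f => (c f)⁻¹) fun f h => by rw [hmul, mul_inv_rev], ?_⟩
  refine (injective_iff_map_eq_one _).2 fun f hf => ?_
  have hcf : c f = 1 := inv_eq_one.1 hf
  refine eq_one_of_transpose_single fun m => ?_
  refine map_mono hqp hcard (transposeEquiv f) (fun g => ?_) m
  rw [transposeEquiv_apply, hc, hcf, one_mul]

end Action

/-- Every group acts faithfully on a coalgebra whose automorphism group embeds into it. -/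
theorem exists_coalgebra (k : Type u) [Field k] [Fintype k] (G : Type v) [Group G] :
    ∃ C : BundledCoalgebra.{max u v} k, HasFaithfulAction k G C ∧
      ∀ (H : Type v) [Group H], HasFaithfulAction k H C →
        ∃ f : H →* G, Function.Injective f := by
  obtain ⟨p, hp⟩ := CharP.exists k
  obtain ⟨e, hprime, hcard⟩ := FiniteField.card k p
  have : Fact p.Prime := ⟨hprime⟩
  have : Fact (2 ≤ Fintype.card k) := ⟨Fintype.one_lt_card⟩
  obtain ⟨inst, hwf⟩ := exists_wellFoundedGT G
  refine ⟨⟨DecompCoalg k (mon (Fintype.card k) G)⟩, ⟨ofAction k monShift monShift_mul,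
    ofAction_injective monShift_injective⟩, fun H _ => ?_⟩
  rintro ⟨a, ha⟩
  obtain ⟨γ, hγ⟩ := exists_injective_coalgAut_hom (q := Fintype.card k) (G := G) hcard rfl
  exact ⟨γ.comp a, hγ.comp ha⟩

end RigidExponent

theorem nonempty_mulEquiv_of_injective {G H : Type*} [Group G] [Group H] (hG : CoHopfian G)
    {a : G →* H} {b : H →* G} (ha : Function.Injective a) (hb : Function.Injective b) :
    Nonempty (G ≃* H) := by
  have h := hG (b.comp a) (hb.comp ha)
  have hb' : Function.Surjective b := fun g => (h g).imp' a fun _ hx => hx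
  exact ⟨(MulEquiv.ofBijective b ⟨hb, hb'⟩).symm⟩

theorem HasFaithfulAction.of_mulEquiv {k : Type u} [Field k] {G H : Type v} [Group G] [Group H]
    (e : G ≃* H) {C : BundledCoalgebra.{w} k} (h : HasFaithfulAction k H C) :
    HasFaithfulAction k G C := by
  obtain ⟨a, ha⟩ := h
  exact ⟨a.comp e.toMonoidHom, ha.comp e.injective⟩

theorem stmt18 (p n : ℕ) (hp : p.Prime) (hn : 0 < n) [Fintype k]
    (hcard : Fintype.card k = p ^ n) (G H : Type v) [Group G] [Group H]
    (hG : InClassG p n G) (hH : InClassG p n H) :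
    Nonempty (G ≃* H) ↔
      ∀ C : BundledCoalgebra.{max u v} k,
        (HasFaithfulAction.{u, v, max u v} k G C ↔ HasFaithfulAction.{u, v, max u v} k H C) := by
  constructor
  · rintro ⟨e⟩ C
    exact ⟨.of_mulEquiv e.symm, .of_mulEquiv e⟩
  · intro h
    obtain ⟨C, hC, hCG⟩ := RigidExponent.exists_coalgebra k G
    obtain ⟨D, hD, hDH⟩ := RigidExponent.exists_coalgebra k H
    obtain ⟨b, hb⟩ := hCG H ((h C).1 hC)
    obtain ⟨a, ha⟩ := hDH G ((h D).2 hD)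
    exact nonempty_mulEquiv_of_injective hG.1 ha hb
end
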